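/- MLR is truth-table Medvedev reducible to Some(MLR, ω): there exists a truth-table reduction Φ such that Φ^X ∈ MLR for every X ∈ Some(MLR, ω). -/

import Mathlib

open MeasureTheory

/-- Cantor space `2^ω`: functions from `ℕ` to `Bool`. -/
abbrev Cantor : Type := ℕ → Bool

/-- The fair-coin product measure on Cantor space (each bit is `true` with probability 1/2,
independently), realized concretely as the pushforward of Lebesgue measure on `[0,1)`
under the binary-digit map `x ↦ (n ↦ n-th binary digit of x)`. -/
noncomputable def fairCoin : Measure Cantor :=
  Measure.map (fun (x : ℝ) (n : ℕ) => decide ((⌊x * 2 ^ (n + 1)⌋ % 2 : ℤ) = 1))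
    (volume.restrict (Set.Ico (0 : ℝ) 1))

/-- The cylinder `[σ]` of all `X ∈ 2^ω` extending the finite binary string `σ`. -/
def cylinder (σ : List Bool) : Set Cantor :=
  {X | ∀ (i : ℕ) (h : i < σ.length), X i = σ.get ⟨i, h⟩}

/-- The `n`-th level `U_n` of a test `U`: the union of the cylinders enumerated by `U n`. -/
def testSet (U : ℕ → ℕ → Option (List Bool)) (n : ℕ) : Set Cantor :=
  ⋃ σ ∈ {σ : List Bool | ∃ k, U n k = some σ}, cylinder σ

/-- A Martin-Löf test: a computable enumeration of cylinders with `μ(U_n) ≤ 2^{-n}`. -/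
def MLTest (U : ℕ → ℕ → Option (List Bool)) : Prop :=
  Computable₂ U ∧ ∀ n, fairCoin (testSet U n) ≤ ((2 : ENNReal) ^ n)⁻¹

/-- The Martin-Löf random elements of Cantor space. -/
def MLR : Set Cantor :=
  {X | ∀ U : ℕ → ℕ → Option (List Bool), MLTest U → ∃ n, X ∉ testSet U n}

/-- The `i`-th column of `X`, via Mathlib's pairing bijection: `X_i(n) = X(⟨i,n⟩)`. -/
def col (X : Cantor) (i : ℕ) : Cantor := fun n => X (Nat.pair i n)

/-- `Some(C, ω)`: some column is in `C`. -/
def SomeOmega (C : Set Cantor) : Set Cantor := {X | ∃ i, col X i ∈ C}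

/-- `Many(C)`: infinitely many columns are in `C`. -/
def Many (C : Set Cantor) : Set Cantor := {X | {i | col X i ∈ C}.Infinite}

/-- The natural number with the given (little-endian) list of bits. -/
def bitsToNat : List Bool → ℕ
  | [] => 0
  | b :: l => (cond b 1 0) + 2 * bitsToNat l

/-- A truth-table reduction, given by query positions `q n` and a truth table `t n`
with one entry for each of the `2^{|q n|}` possible bit-vectors of answers;
the pair must be computable (as a function of `n`), uniformly. -/
def TTReduction (q : ℕ → List ℕ) (t : ℕ → List Bool) : Prop :=
  Computable (fun n => (q n, t n)) ∧ ∀ n, (t n).length = 2 ^ (q n).length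

/-- The output `Φ^X` of the truth-table reduction given by `(q, t)` on oracle `X`:
bit `n` is the entry of `t n` indexed by the bit-vector of oracle answers. -/
def ttEval (q : ℕ → List ℕ) (t : ℕ → List Bool) (X : Cantor) : Cantor :=
  fun n => (t n).getD (bitsToNat ((q n).map X)) false


/-- The initial segment of length `n`. -/
def pre (X : Cantor) (n : ℕ) : List Bool := (List.range n).map X

@[simp] lemma pre_length (X : Cantor) (n : ℕ) : (pre X n).length = n := by simp [pre]

lemma mem_cyl {X : Cantor} {σ : List Bool} : X ∈ cylinder σ ↔ pre X σ.length = σ := by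
  constructor
  · intro h
    apply List.ext_getElem (by simp)
    intro i h1 h2
    simpa [pre] using h i h2
  · intro h i hi
    have : (pre X σ.length)[i]? = σ[i]? := by rw [h]
    simpa [pre, hi] using this

lemma mem_cyl_of_le {X : Cantor} {σ : List Bool} {L : ℕ} (hL : σ.length ≤ L) :
    X ∈ cylinder σ ↔ σ <+: pre X L := by
  rw [mem_cyl, List.prefix_iff_eq_take, pre, pre, ← List.map_take, List.take_range,
    min_eq_left hL, eq_comm]

/-- the binary digits -/
noncomputable def digs (x : ℝ) (n : ℕ) : Bool := decide ((⌊x * 2 ^ (n + 1)⌋ % 2 : ℤ) = 1)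

lemma floor_half (x : ℝ) (n : ℕ) :
    ⌊x * 2 ^ (n + 1)⌋ / 2 = ⌊x * 2 ^ n⌋ := by
  symm
  rw [Int.floor_eq_iff]
  have h1 := Int.floor_le (x * 2 ^ (n + 1))
  have h2 := Int.lt_floor_add_one (x * 2 ^ (n + 1))
  set m := ⌊x * 2 ^ (n + 1)⌋
  have h3 : m / 2 * 2 ≤ m := by omega
  have h4 : m + 1 ≤ m / 2 * 2 + 2 := by omega
  have hh3 : ((m / 2 : ℤ) : ℝ) * 2 ≤ m := by exact_mod_cast h3
  have hh4 : (m : ℝ) + 1 ≤ ((m / 2 : ℤ) : ℝ) * 2 + 2 := by exact_mod_cast h4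
  rw [pow_succ] at h1 h2
  constructor <;> linarith

lemma digs_cyl (σ : List Bool) : ∃ v : ℤ, ∀ x : ℝ,
    (x ∈ Set.Ico (0 : ℝ) 1 ∧ digs x ∈ cylinder σ) ↔ ⌊x * 2 ^ σ.length⌋ = v := by
  induction σ using List.reverseRecOn with
  | nil =>
    refine ⟨0, fun x => ?_⟩
    simp [_root_.cylinder, Int.floor_eq_iff]
  | append_singleton l b ih =>
    obtain ⟨v, hv⟩ := ih
    refine ⟨2 * v + (if b then 1 else 0), fun x => ?_⟩
    have : digs x ∈ cylinder (l ++ [b]) ↔ digs x ∈ cylinder l ∧ digs x l.length = b := by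
      rw [mem_cyl, mem_cyl]
      simp only [pre, List.length_append, List.length_singleton, List.range_succ, List.map_append]
      constructor
      · intro h
        have := List.append_inj h (by simp)
        simpa using this
      · rintro ⟨h1, h2⟩
        rw [h1]
        simp [h2]
    rw [this, ← and_assoc, hv, ← floor_half]
    simp only [List.length_append, List.length_singleton, digs]
    generalize ⌊x * 2 ^ (l.length + 1)⌋ = m
    cases b <;> simp <;> omega

lemma digs_meas : Measurable digs := by
  rw [measurable_pi_iff]
  intro n
  unfold digs
  have : Measurable fun z : ℤ => decide (z % 2 = 1) := measurable_from_top
  exact this.comp (Int.measurable_floor.comp (measurable_id.mul_const _))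

lemma cyl_meas (σ : List Bool) : MeasurableSet (cylinder σ) := by
  have : cylinder σ = ⋂ i : Fin σ.length, (fun X : Cantor => X i) ⁻¹' {σ.get i} := by
    ext X
    simp [_root_.cylinder, Fin.forall_iff]
  rw [this]
  exact MeasurableSet.iInter fun i => measurable_pi_apply _ (measurableSet_singleton _)

lemma cyl_measure (σ : List Bool) : fairCoin (cylinder σ) = ((2 : ENNReal) ^ σ.length)⁻¹ := by
  obtain ⟨v, hv⟩ := digs_cyl σ
  change Measure.map digs _ _ = _
  rw [Measure.map_apply digs_meas (cyl_meas σ), Measure.restrict_apply (digs_meas (cyl_meas σ))]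
  have : digs ⁻¹' cylinder σ ∩ Set.Ico 0 1
      = Set.Ico ((v : ℝ) / 2 ^ σ.length) ((v + 1) / 2 ^ σ.length) := by
    ext x
    rw [Set.mem_inter_iff, and_comm, Set.mem_preimage, hv, Int.floor_eq_iff, Set.mem_Ico,
      div_le_iff₀ (by positivity), lt_div_iff₀ (by positivity)]
  rw [this, Real.volume_Ico, ← sub_div, add_sub_cancel_left, one_div,
    ENNReal.ofReal_inv_of_pos (by positivity), ENNReal.ofReal_pow (by norm_num)]
  simp

instance : IsProbabilityMeasure fairCoin := ⟨by
  have := cyl_measure []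
  have h : cylinder [] = Set.univ := by ext; simp [_root_.cylinder]
  simpa [h] using this⟩

/-- All binary strings of a given length. -/
def strs (L : ℕ) : List (List Bool) :=
  Nat.rec [[]] (fun _ r => r.flatMap fun s => [false :: s, true :: s]) L

lemma strs_succ (L : ℕ) :
    strs (L + 1) = (strs L).flatMap fun s => [false :: s, true :: s] := rfl

lemma mem_strs {L : ℕ} {s : List Bool} : s ∈ strs L ↔ s.length = L := by
  induction L generalizing s with
  | zero => simp [strs]
  | succ L ih =>
    rw [strs_succ]
    cases s with
    | nil => simp
    | cons b s => cases b <;> simp [ih]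

lemma strs_length (L : ℕ) : (strs L).length = 2 ^ L := by
  induction L with
  | zero => simp [strs]
  | succ L ih =>
    rw [strs_succ, pow_succ, ← ih]
    simp [List.length_flatMap]

lemma flatMap_pair {α β : Type} (f g : α → β) (l : List α) (k : ℕ) :
    (l.flatMap fun s => [f s, g s])[2 * k]? = l[k]?.map f ∧
    (l.flatMap fun s => [f s, g s])[2 * k + 1]? = l[k]?.map g := by
  induction l generalizing k with
  | nil => simp
  | cons a l ih =>
    cases k with
    | zero => simp
    | succ k => simpa [Nat.mul_add] using ih k

lemma strs_get (l : List Bool) : (strs l.length)[bitsToNat l]? = some l := by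
  induction l with
  | nil => simp [strs, bitsToNat]
  | cons b l ih =>
    rw [List.length_cons, strs_succ, bitsToNat]
    have h := flatMap_pair (fun s => false :: s) (fun s => true :: s) (strs l.length) (bitsToNat l)
    rw [ih] at h
    cases b
    · simpa using h.1
    · simpa [add_comm] using h.2

lemma strs_nodup (L : ℕ) : (strs L).Nodup := by
  induction L with
  | zero => simp [strs]
  | succ L ih =>
    rw [strs_succ, List.nodup_flatMap]
    refine ⟨by simp, ih.imp ?_⟩
    intro a b hab
    simp [Function.onFun, hab, List.Disjoint]

/-- The open set given by a list of strings. -/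
def opn (S : List (List Bool)) : Set Cantor := ⋃ σ ∈ S, cylinder σ

/-- A length bound. -/
def lenSum (S : List (List Bool)) : ℕ := S.flatten.length

open Classical in
noncomputable def cnt (S : List (List Bool)) : List (List Bool) :=
  (strs (lenSum S)).filter fun τ => ∃ σ ∈ S, σ <+: τ

lemma le_lenSum {S : List (List Bool)} {σ : List Bool} (h : σ ∈ S) : σ.length ≤ lenSum S := 
  (List.sublist_flatten_of_mem h).length_le

lemma opn_eq (S : List (List Bool)) : opn S = ⋃ τ ∈ (cnt S).toFinset, cylinder τ := by
  classical
  ext X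
  simp only [opn, Set.mem_iUnion, exists_prop, List.mem_toFinset, cnt, List.mem_filter, mem_strs,
    decide_eq_true_eq]
  constructor
  · rintro ⟨σ, h, hX⟩
    refine ⟨pre X (lenSum S), ⟨by simp, σ, h, (mem_cyl_of_le (le_lenSum h)).1 hX⟩, ?_⟩
    rw [mem_cyl]; simp
  · rintro ⟨τ, ⟨h1, σ, h, hp⟩, hX⟩
    refine ⟨σ, h, (mem_cyl_of_le (le_lenSum h)).2 ?_⟩
    rw [mem_cyl, h1] at hX
    rwa [hX]

lemma opn_measure (S : List (List Bool)) :
    fairCoin (opn S) = (cnt S).length * ((2 : ENNReal) ^ lenSum S)⁻¹ := by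
  have hmem : ∀ τ ∈ (cnt S).toFinset, τ.length = lenSum S := by
    intro τ h
    rw [List.mem_toFinset] at h
    exact mem_strs.1 (List.mem_of_mem_filter h)
  rw [opn_eq, measure_biUnion_finset, Finset.sum_congr rfl (g := fun _ => ((2 : ENNReal) ^ lenSum S)⁻¹),
    Finset.sum_const, List.toFinset_card_of_nodup, nsmul_eq_mul]
  · exact (strs_nodup _).filter _
  · intro τ h
    rw [cyl_measure, hmem τ h]
  · intro a ha b hb hab
    refine Set.disjoint_left.2 fun X h1 h2 => hab ?_
    rw [mem_cyl, hmem _ ha] at h1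
    rw [mem_cyl, hmem _ hb] at h2
    rw [← h1, h2]
  · exact fun τ _ => cyl_meas τ

lemma opn_le_iff (S : List (List Bool)) (n : ℕ) :
    fairCoin (opn S) ≤ ((2 : ENNReal) ^ n)⁻¹ ↔
      (cnt S).length * (strs n).length ≤ (strs (lenSum S)).length := by
  rw [opn_measure, strs_length, strs_length, ← div_eq_mul_inv,
    ENNReal.div_le_iff (by simp) (by simp), mul_comm _⁻¹, ← div_eq_mul_inv,
    ENNReal.le_div_iff_mul_le (by simp) (by simp)]
  exact_mod_cast Iff.rfl

lemma strs_prim : Primrec strs := by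
  refine Primrec.nat_rec₁ _ ?_
  refine Primrec.list_flatMap Primrec.snd ?_
  have h (b : Bool) : Primrec fun p : (ℕ × List (List Bool)) × List Bool => b :: p.2 :=
    Primrec.list_cons.comp (Primrec.const b) Primrec.snd
  exact Primrec.list_cons.comp (h false) (Primrec.list_cons.comp (h true) (Primrec.const []))

lemma pref_prim : PrimrecRel (fun σ τ : List Bool => σ <+: τ) := by
  have : PrimrecRel fun σ τ : List Bool => σ = τ.take σ.length :=
    Primrec.eq.comp Primrec.fst
      (Primrec.list_take.comp (Primrec.list_length.comp Primrec.fst) Primrec.snd)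
  exact this.of_eq fun σ τ => (List.prefix_iff_eq_take).symm

lemma lenSum_prim : Primrec lenSum := Primrec.list_length.comp Primrec.list_flatten

lemma cnt_prim : Primrec cnt := by
  classical
  have h : PrimrecRel fun (τ : List Bool) (S : List (List Bool)) => ∃ σ ∈ S, σ <+: τ :=
    (PrimrecRel.exists_mem_list pref_prim).comp Primrec.snd Primrec.fst
  have := (PrimrecRel.listFilter h).comp (strs_prim.comp lenSum_prim) Primrec.id
  refine this.of_eq fun S => ?_
  simp only [cnt]
  congr

lemma opn_prim : PrimrecRel fun (S : List (List Bool)) (n : ℕ) =>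
    fairCoin (opn S) ≤ ((2 : ENNReal) ^ n)⁻¹ := by
  have : PrimrecRel fun (S : List (List Bool)) (n : ℕ) =>
      (cnt S).length * (strs n).length ≤ (strs (lenSum S)).length :=
    Primrec.nat_le.comp (Primrec.nat_mul.comp
      (Primrec.list_length.comp (cnt_prim.comp Primrec.fst))
      (Primrec.list_length.comp (strs_prim.comp Primrec.snd)))
      (Primrec.list_length.comp (strs_prim.comp (lenSum_prim.comp Primrec.fst)))
  exact this.of_eq fun S n => (opn_le_iff S n).symm

/-! ### Closure under finite modifications -/

/-- Flip the bits of `X` given by `δ`. -/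
def flipBy (δ : List Bool) (X : Cantor) : Cantor := fun n => xor (X n) (δ.getD n false)

/-- Flip the bits of a string given by `δ`. -/
def flipL (δ σ : List Bool) : List Bool :=
  (List.range σ.length).map fun i => xor (σ.getD i false) (δ.getD i false)

@[simp] lemma flipL_length (δ σ : List Bool) : (flipL δ σ).length = σ.length := by simp [flipL]

lemma mem_flip {δ σ : List Bool} {X : Cantor} :
    flipBy δ X ∈ cylinder σ ↔ X ∈ cylinder (flipL δ σ) := by
  simp only [_root_.cylinder, Set.mem_ofPred_eq, flipL_length]
  refine forall_congr' fun i => forall_congr' fun h => ?_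
  simp only [flipBy, flipL, List.get_eq_getElem, List.getElem_map, List.getElem_range,
    List.getD_eq_getElem _ _ h]
  generalize X i = a
  generalize σ[i] = b
  generalize δ.getD i false = c
  revert a b c; decide

lemma flip_meas (δ : List Bool) : Measurable (flipBy δ) := by
  rw [measurable_pi_iff]
  intro n
  have : Measurable fun z : Bool => xor z (δ.getD n false) := measurable_from_top
  exact this.comp (measurable_pi_apply n)

lemma gen_cyl : (MeasurableSpace.pi : MeasurableSpace Cantor)
    = MeasurableSpace.generateFrom (Set.range cylinder) := by
  apply le_antisymm
  · refine iSup_le fun i => ?_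
    rw [← measurable_iff_comap_le]
    let _ : MeasurableSpace Cantor := MeasurableSpace.generateFrom (Set.range cylinder)
    refine measurable_to_countable' fun b => ?_
    have : (fun X : Cantor => X i) ⁻¹' {b}
        = ⋃ σ ∈ {σ : List Bool | σ[i]? = some b}, cylinder σ := by
      ext X
      simp only [Set.mem_preimage, Set.mem_singleton_iff, Set.mem_iUnion, Set.mem_ofPred_eq,
        exists_prop]
      constructor
      · intro h
        refine ⟨pre X (i + 1), by simp [pre, h], ?_⟩
        rw [mem_cyl]; simp
      · rintro ⟨σ, h, hX⟩
        obtain ⟨hi, h⟩ := List.getElem?_eq_some_iff.1 h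
        rw [← h]
        exact hX i hi
    rw [this]
    exact MeasurableSet.biUnion (Set.to_countable _)
      fun σ _ => MeasurableSpace.measurableSet_generateFrom ⟨σ, rfl⟩
  · refine MeasurableSpace.generateFrom_le ?_
    rintro _ ⟨σ, rfl⟩
    exact cyl_meas σ

lemma cyl_inter {σ τ : List Bool} (h : σ.length ≤ τ.length) {X : Cantor}
    (h1 : X ∈ cylinder σ) (h2 : X ∈ cylinder τ) : cylinder τ ⊆ cylinder σ := by
  intro Y hY
  rw [mem_cyl_of_le h] at h1 ⊢
  rw [mem_cyl] at h2 hY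
  rwa [hY, ← h2]

lemma pi_cyl : IsPiSystem (Set.range (cylinder : List Bool → Set Cantor)) := by
  rintro _ ⟨σ, rfl⟩ _ ⟨τ, rfl⟩ ⟨X, h1, h2⟩
  rcases le_total σ.length τ.length with h | h
  · exact ⟨τ, (Set.inter_eq_self_of_subset_right (cyl_inter h h1 h2)).symm⟩
  · exact ⟨σ, (Set.inter_eq_self_of_subset_left (cyl_inter h h2 h1)).symm⟩

lemma flip_map (δ : List Bool) : fairCoin.map (flipBy δ) = fairCoin := by
  have : IsProbabilityMeasure (fairCoin.map (flipBy δ)) :=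
    Measure.isProbabilityMeasure_map (flip_meas δ).aemeasurable
  refine ext_of_generate_finite _ gen_cyl pi_cyl ?_ (by simp)
  rintro _ ⟨σ, rfl⟩
  rw [Measure.map_apply (flip_meas δ) (cyl_meas σ)]
  have : flipBy δ ⁻¹' cylinder σ = cylinder (flipL δ σ) := by
    ext X; exact mem_flip
  rw [this, cyl_measure, cyl_measure, flipL_length]

lemma mem_testSet {U : ℕ → ℕ → Option (List Bool)} {n : ℕ} {X : Cantor} :
    X ∈ testSet U n ↔ ∃ k σ, U n k = some σ ∧ X ∈ cylinder σ := by
  simp only [testSet, Set.mem_iUnion, Set.mem_ofPred_eq, exists_prop]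
  constructor
  · rintro ⟨σ, ⟨k, h⟩, hX⟩; exact ⟨k, σ, h, hX⟩
  · rintro ⟨k, σ, h, hX⟩; exact ⟨σ, ⟨k, h⟩, hX⟩

lemma testSet_meas (U : ℕ → ℕ → Option (List Bool)) (n : ℕ) : MeasurableSet (testSet U n) :=
  MeasurableSet.biUnion (Set.to_countable _) fun σ _ => cyl_meas σ

lemma flipL_prim (δ : List Bool) : Primrec (flipL δ) := by
  refine Primrec.list_map (Primrec.list_range.comp Primrec.list_length) ?_
  exact (Primrec.dom_finite fun p : Bool × Bool => xor p.1 p.2).comp (Primrec.pair ((Primrec.list_getD false).comp Primrec.fst Primrec.snd)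
    ((Primrec.list_getD false).comp (Primrec.const δ) Primrec.snd))

lemma flip_mlr {δ : List Bool} {X : Cantor} (hX : X ∈ MLR) : flipBy δ X ∈ MLR := by
  intro U hU
  have key : ∀ n, testSet (fun n k => (U n k).map (flipL δ)) n = flipBy δ ⁻¹' testSet U n := by
    intro n
    ext Y
    rw [Set.mem_preimage, mem_testSet, mem_testSet]
    constructor
    · rintro ⟨k, σ, h, hY⟩
      obtain ⟨τ, h1, rfl⟩ := Option.map_eq_some_iff.1 h
      exact ⟨k, τ, h1, mem_flip.2 hY⟩
    · rintro ⟨k, σ, h, hY⟩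
      exact ⟨k, flipL δ σ, by simp [h], mem_flip.1 hY⟩
  have hT : MLTest (fun n k => (U n k).map (flipL δ)) := by
    refine ⟨?_, fun n => ?_⟩
    · exact Computable.option_map hU.1 ((flipL_prim δ).to_comp.comp Computable.snd)
    · rw [key, ← Measure.map_apply (flip_meas δ) (testSet_meas U n), flip_map]
      exact hU.2 n
  obtain ⟨n, hn⟩ := hX _ hT
  exact ⟨n, by rwa [key] at hn⟩

lemma mlr_of_eventually {X Y : Cantor} (hX : X ∈ MLR) {N : ℕ} (h : ∀ n ≥ N, Y n = X n) :
    Y ∈ MLR := by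
  have : Y = flipBy ((List.range N).map fun i => xor (X i) (Y i)) X := by
    funext n
    rcases lt_or_ge n N with hn | hn
    · simp [flipBy, hn]
    · simp [flipBy, hn, h n hn]
  rw [this]
  exact flip_mlr hX

/-! ### The universal test -/

open Nat.Partrec (Code)

/-- Stage `s` of the `n`-th level of the `e`-th candidate test. -/
def approx (e n s : ℕ) : List (List Bool) :=
  (List.range s).filterMap fun j =>
    (Code.evaln s (Denumerable.ofNat Code e) (Nat.pair n j)).bind fun m =>
      (Encodable.decode (α := Option (List Bool)) m).bind id

lemma approx_prim : Primrec fun p : ℕ × ℕ × ℕ => approx p.1 p.2.1 p.2.2 := by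
  refine Primrec.listFilterMap (Primrec.list_range.comp (Primrec.snd.comp Primrec.snd)) ?_
  refine Primrec.option_bind (Code.primrec_evaln.comp (Primrec.pair (Primrec.pair ?_ ?_) ?_)) ?_
  · exact (Primrec.snd.comp Primrec.snd).comp Primrec.fst
  · exact (Primrec.ofNat Code).comp (Primrec.fst.comp Primrec.fst)
  · exact Primrec₂.natPair.comp ((Primrec.fst.comp Primrec.snd).comp Primrec.fst) Primrec.snd
  · exact Primrec.option_bind (Primrec.decode.comp Primrec.snd) Primrec.snd

lemma mem_approx {e n s : ℕ} {σ : List Bool} : σ ∈ approx e n s ↔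
    ∃ j < s, ∃ m ∈ Code.evaln s (Denumerable.ofNat Code e) (Nat.pair n j),
      Encodable.decode (α := Option (List Bool)) m = some (some σ) := by
  simp [approx, List.mem_filterMap, List.mem_range, Option.bind_eq_some_iff]

lemma approx_mono {e n s ss : ℕ} (h : s ≤ ss) : opn (approx e n s) ⊆ opn (approx e n ss) := by
  refine Set.biUnion_subset_biUnion_left fun σ hσ => ?_
  obtain ⟨j, hj, m, hm, hd⟩ := mem_approx.1 hσ
  exact mem_approx.2 ⟨j, hj.trans_le h, m, Code.evaln_mono h hm, hd⟩

open Classical in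
/-- The universal Martin-Löf test. -/
noncomputable def univTest (c k : ℕ) : Option (List Bool) :=
  if fairCoin (opn (approx k.unpair.1 (c + k.unpair.1 + 1) k.unpair.2.unpair.1))
      ≤ ((2 : ENNReal) ^ (c + k.unpair.1 + 1))⁻¹ then
    (approx k.unpair.1 (c + k.unpair.1 + 1) k.unpair.2.unpair.1)[k.unpair.2.unpair.2]?
  else none

lemma univTest_prim : Primrec₂ univTest := by
  have e : Primrec fun p : ℕ × ℕ => p.2.unpair.1 :=
    Primrec.fst.comp (Primrec.unpair.comp Primrec.snd)
  have r : Primrec fun p : ℕ × ℕ => p.2.unpair.2.unpair :=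
    Primrec.unpair.comp (Primrec.snd.comp (Primrec.unpair.comp Primrec.snd))
  have n : Primrec fun p : ℕ × ℕ => p.1 + p.2.unpair.1 + 1 :=
    Primrec.succ.comp (Primrec.nat_add.comp Primrec.fst e)
  have a : Primrec fun p : ℕ × ℕ =>
      approx p.2.unpair.1 (p.1 + p.2.unpair.1 + 1) p.2.unpair.2.unpair.1 :=
    approx_prim.comp (Primrec.pair e (Primrec.pair n (Primrec.fst.comp r)))
  refine Primrec.ite (opn_prim.comp a n) ?_ (Primrec.const none)
  exact Primrec.list_getElem?.comp a (Primrec.snd.comp r)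

lemma mem_univ {c : ℕ} {X : Cantor} : X ∈ testSet univTest c ↔
    ∃ e s, fairCoin (opn (approx e (c + e + 1) s)) ≤ ((2 : ENNReal) ^ (c + e + 1))⁻¹ ∧
      X ∈ opn (approx e (c + e + 1) s) := by
  rw [mem_testSet]
  constructor
  · rintro ⟨k, σ, h, hX⟩
    unfold univTest at h
    split_ifs at h with hc
    exact ⟨_, _, hc, Set.mem_biUnion (List.mem_of_getElem? h) hX⟩
  · rintro ⟨e, s, hc, hX⟩
    simp only [opn, Set.mem_iUnion, exists_prop] at hX
    obtain ⟨σ, hσ, hX⟩ := hX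
    obtain ⟨j, hj⟩ := List.mem_iff_getElem?.1 hσ
    refine ⟨Nat.pair e (Nat.pair s j), σ, ?_, hX⟩
    simp [univTest, hc, hj]

lemma univ_test : MLTest univTest := by
  refine ⟨univTest_prim.to_comp, fun c => ?_⟩
  have : testSet univTest c = ⋃ e, ⋃ s : {s // fairCoin (opn (approx e (c + e + 1) s))
      ≤ ((2 : ENNReal) ^ (c + e + 1))⁻¹}, opn (approx e (c + e + 1) s) := by
    ext X
    simp [mem_univ]
  rw [this]
  refine (measure_iUnion_le _).trans ?_
  have h2 : ∑' e : ℕ, ((2 : ENNReal) ^ (c + e + 1))⁻¹ = ((2 : ENNReal) ^ c)⁻¹ := by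
    have := ENNReal.tsum_geometric_add_one (2⁻¹ : ENNReal)
    have h3 : ∀ e : ℕ, ((2 : ENNReal) ^ (c + e + 1))⁻¹ = ((2 : ENNReal) ^ c)⁻¹ * 2⁻¹ ^ (e + 1) := by
      intro e
      rw [add_assoc, pow_add, ENNReal.mul_inv (by simp) (by simp), ENNReal.inv_pow, ENNReal.inv_pow]
    rw [tsum_congr h3, ENNReal.tsum_mul_left, this, ENNReal.one_sub_inv_two,
      ENNReal.mul_inv_cancel (by simp) (by simp), mul_one]
  rw [← h2]
  refine ENNReal.tsum_le_tsum fun e => ?_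
  rw [Directed.measure_iUnion]
  · exact iSup_le fun s => s.2
  · intro s t
    rcases le_total s.1 t.1 with h | h
    · exact ⟨t, approx_mono h, subset_rfl⟩
    · exact ⟨s, subset_rfl, approx_mono h⟩

lemma mlr_of_not_mem {c : ℕ} {X : Cantor} (h : X ∉ testSet univTest c) : X ∈ MLR := by
  intro U hU
  have h1 : Nat.Partrec fun m => Part.some (Encodable.encode (U m.unpair.1 m.unpair.2)) := by
    have h2 : Computable fun m : ℕ => U m.unpair.1 m.unpair.2 :=
      Computable₂.comp hU.1 (Computable.fst.comp Computable.unpair)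
        (Computable.snd.comp Computable.unpair)
    exact Partrec.nat_iff.1 (Computable.encode.comp h2)
  obtain ⟨cd, hcd⟩ := Code.exists_code.1 h1
  obtain ⟨e, rfl⟩ : ∃ e, Denumerable.ofNat Code e = cd :=
    ⟨Encodable.encode cd, Denumerable.ofNat_encode cd⟩
  have hmem : ∀ n s, opn (approx e n s) ⊆ testSet U n := by
    intro n s
    refine Set.iUnion₂_subset fun σ hσ Y hY => ?_
    obtain ⟨j, hj, m, hm, hd⟩ := mem_approx.1 hσ
    have := Code.evaln_sound hm
    rw [hcd] at this
    simp only [Nat.unpair_pair, Part.mem_some_iff] at this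
    rw [this, Encodable.encodek, Option.some.injEq] at hd
    exact mem_testSet.2 ⟨j, σ, hd, hY⟩
  refine ⟨c + e + 1, fun hX => h ?_⟩
  obtain ⟨k, σ, hk, hX⟩ := mem_testSet.1 hX
  have : Encodable.encode (some σ) ∈
      (Denumerable.ofNat Code e).eval (Nat.pair (c + e + 1) k) := by
    rw [hcd]; simp [hk]
  obtain ⟨s, hs⟩ := Code.evaln_complete.1 this
  refine mem_univ.2 ⟨e, max s (k + 1), (measure_mono (hmem _ _)).trans (hU.2 _), ?_⟩
  exact Set.mem_biUnion (mem_approx.2 ⟨k, by simp, _, Code.evaln_mono (le_max_left _ _) hs,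
    Encodable.encodek _⟩) hX

/-! ### The reduction -/

/-- Number of queried bits. -/
def bd (n : ℕ) : ℕ := Nat.pair n n + 1

/-- `p = ⟨i, c⟩` looks bad at stage `n`: column `i` of `x` has been seen to enter level `c`. -/
def refuted (x : List Bool) (n p : ℕ) : Prop :=
  ∃ σ ∈ (List.range n).filterMap (univTest p.unpair.2),
    σ.map some = (List.range σ.length).map fun i => x[Nat.pair p.unpair.1 i]?

lemma refuted_prim : PrimrecPred fun a : (ℕ × List Bool) × ℕ => refuted a.1.2 a.1.1 a.2 := by
  have h : PrimrecRel fun (σ : List Bool) (a : (ℕ × List Bool) × ℕ) =>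
      σ.map some = (List.range σ.length).map fun i => a.1.2[Nat.pair a.2.unpair.1 i]? := by
    refine Primrec.eq.comp (Primrec.list_map Primrec.fst (Primrec.option_some.comp Primrec.snd))
      (Primrec.list_map (Primrec.list_range.comp (Primrec.list_length.comp Primrec.fst)) ?_)
    have h1 : Primrec fun q : (List Bool × (ℕ × List Bool) × ℕ) × ℕ => q.1.2 :=
      Primrec.snd.comp Primrec.fst
    exact Primrec.list_getElem?.comp (Primrec.snd.comp (Primrec.fst.comp h1))
      (Primrec₂.natPair.comp (Primrec.fst.comp (Primrec.unpair.comp (Primrec.snd.comp h1)))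
        Primrec.snd)
  refine (PrimrecRel.exists_mem_list h).comp (Primrec.listFilterMap ?_ ?_) Primrec.id
  · exact Primrec.list_range.comp (Primrec.fst.comp Primrec.fst)
  · exact univTest_prim.comp (Primrec.snd.comp (Primrec.unpair.comp
      (Primrec.snd.comp Primrec.fst))) Primrec.snd

open Classical in
/-- The current guess. -/
noncomputable def guess (a : ℕ × List Bool) : ℕ :=
  (List.range (a.1 + 1)).findIdx fun p => decide (¬ refuted a.2 a.1 p)

lemma guess_prim : Primrec guess := by
  classical
  refine Primrec.list_findIdx (Primrec.list_range.comp (Primrec.succ.comp Primrec.fst)) ?_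
  exact (PrimrecPred.not refuted_prim).decide

/-- The output bit. -/
noncomputable def out (a : ℕ × List Bool) : Bool :=
  a.2.getD (Nat.pair (guess a).unpair.1 a.1) false

lemma out_prim : Primrec out :=
  (Primrec.list_getD false).comp Primrec.snd
    (Primrec₂.natPair.comp (Primrec.fst.comp (Primrec.unpair.comp guess_prim)) Primrec.fst)

lemma bd_prim : Primrec bd := Primrec.succ.comp (Primrec₂.natPair.comp Primrec.id Primrec.id)

lemma pair_mono {a b c d : ℕ} (h1 : a ≤ c) (h2 : b ≤ d) : Nat.pair a b ≤ Nat.pair c d :=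
  ((strictMono_id.monotone : Monotone (id : ℕ → ℕ)) <| by
    refine le_trans (b := Nat.pair c b) ?_ ?_
    · rcases h1.eq_or_lt with rfl | h
      · exact le_rfl
      · exact (Nat.pair_lt_pair_left b h).le
    · rcases h2.eq_or_lt with rfl | h
      · exact le_rfl
      · exact (Nat.pair_lt_pair_right c h).le)

lemma pre_get {X : Cantor} {n i : ℕ} (h : i < n) : (pre X n)[i]? = some (X i) := by
  simp [pre, h]

lemma refuted_sound {X : Cantor} {n p : ℕ} (h : refuted (pre X (bd n)) n p) :
    col X p.unpair.1 ∈ testSet univTest p.unpair.2 := by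
  obtain ⟨σ, hσ, he⟩ := h
  obtain ⟨k, -, hk⟩ := List.mem_filterMap.1 hσ
  refine mem_testSet.2 ⟨k, σ, hk, fun i hi => ?_⟩
  have : (σ.map some)[i]? = ((List.range σ.length).map fun i =>
    (pre X (bd n))[Nat.pair p.unpair.1 i]?)[i]? := by rw [he]
  simp only [List.getElem?_map, List.getElem?_range hi, List.getElem?_eq_getElem hi,
    Option.map_some, Option.some.injEq] at this
  rw [pre, List.getElem?_map, eq_comm, Option.map_eq_some_iff] at this
  obtain ⟨m, hm, hm2⟩ := this
  obtain ⟨_, hm⟩ := List.getElem?_eq_some_iff.1 hm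
  rw [List.getElem_range] at hm
  subst hm
  exact hm2

lemma refuted_complete {X : Cantor} {p : ℕ}
    (h : col X p.unpair.1 ∈ testSet univTest p.unpair.2) :
    ∃ N, ∀ n ≥ N, refuted (pre X (bd n)) n p := by
  obtain ⟨k, σ, hk, hX⟩ := mem_testSet.1 h
  refine ⟨k + 1 + p.unpair.1 + σ.length, fun n hn => ⟨σ, ?_, ?_⟩⟩
  · exact List.mem_filterMap.2 ⟨k, List.mem_range.2 (by omega), hk⟩
  · apply List.ext_getElem (by simp)
    intro i h1 h2
    rw [List.length_map] at h1
    rw [List.getElem_map, List.getElem_map, List.getElem_range, pre_get]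
    · exact congrArg some (hX i h1).symm
    · exact Nat.lt_succ_of_le (pair_mono (by omega) (by omega))

lemma guess_eq {x : List Bool} {n p : ℕ} (hp : p ≤ n) (h1 : ¬ refuted x n p)
    (h2 : ∀ pp < p, refuted x n pp) : guess (n, x) = p := by
  classical
  unfold guess
  rw [List.findIdx_eq (by simp; omega)]
  constructor
  · simpa using h1
  · intro j hj
    simpa using h2 j hj

lemma out_mlr {X : Cantor} (hX : X ∈ SomeOmega MLR) :
    (fun n => out (n, pre X (bd n))) ∈ MLR := by
  classical
  obtain ⟨i, hi⟩ := hX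
  obtain ⟨c, hc⟩ := hi univTest univ_test
  have hex : ∃ p : ℕ, col X p.unpair.1 ∉ testSet univTest p.unpair.2 :=
    ⟨Nat.pair i c, by simpa using hc⟩
  obtain ⟨p, hp, hmin⟩ : ∃ p : ℕ, col X p.unpair.1 ∉ testSet univTest p.unpair.2 ∧
      ∀ pp < p, col X pp.unpair.1 ∈ testSet univTest pp.unpair.2 :=
    ⟨Nat.find hex, Nat.find_spec hex, fun pp h => not_not.1 (Nat.find_min hex h)⟩
  have hN : ∃ N, ∀ pp < p, ∀ n ≥ N, refuted (pre X (bd n)) n pp := by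
    choose! f hf using fun pp h => refuted_complete (hmin pp h)
    refine ⟨(Finset.range p).sup f, fun pp h n hn => hf pp h n (le_trans ?_ hn)⟩
    exact Finset.le_sup (f := f) (Finset.mem_range.2 h)
  obtain ⟨N, hN⟩ := hN
  refine mlr_of_eventually (mlr_of_not_mem hp) (N := max N p) fun n hn => ?_
  have hg : guess (n, pre X (bd n)) = p :=
    guess_eq (le_trans (le_max_right _ _) hn) (fun h => hp (refuted_sound h))
      fun pp h => hN pp h n (le_trans (le_max_left _ _) hn)
  simp only [out, hg, List.getD_eq_getElem?_getD]
  rw [pre_get]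
  · rfl
  · exact Nat.lt_succ_of_le (pair_mono
      ((Nat.unpair_left_le p).trans (le_trans (le_max_right _ _) hn)) le_rfl)

/-- MLR is truth-table Medvedev reducible to `Some(MLR, ω)`. -/
theorem mlr_le_stt_someOmega_mlr :
    ∃ (q : ℕ → List ℕ) (t : ℕ → List Bool), TTReduction q t ∧
      ∀ X ∈ SomeOmega MLR, ttEval q t X ∈ MLR := by
  refine ⟨fun n => List.range (bd n), fun n => (strs (bd n)).map fun x => out (n, x),
    ⟨?_, fun n => by simp [strs_length]⟩, fun X hX => ?_⟩
  · refine (Primrec.pair (Primrec.list_range.comp bd_prim)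
      (Primrec.list_map (strs_prim.comp bd_prim) ?_)).to_comp
    exact out_prim
  · convert out_mlr hX using 1
    funext n
    have := strs_get (pre X (bd n))
    rw [pre_length] at this
    simp only [ttEval, List.getD_eq_getElem?_getD]
    change ((List.map _ _)[bitsToNat (pre X (bd n))]?).getD false = _
    rw [List.getElem?_map, this]
    rfl
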